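/- Let F be an FN lattice (a simple, infinite, semidistributive lattice) and let F⁺ denote F with a new greatest element adjoined. Then F⁺ is an infinite semidistributive lattice and the congruence lattice Con F⁺ is a three-element chain; its unique nontrivial proper congruence has exactly one nontrivial congruence class, namely F. -/

import Mathlib

/-! ### Basic definitions: semidistributivity, lattice congruences -/

/-- Join-semidistributivity: `u = x ⊔ y = x ⊔ z` implies `u = x ⊔ (y ⊓ z)`. -/
def JoinSD (L : Type*) [Lattice L] : Prop :=
  ∀ u x y z : L, u = x ⊔ y → u = x ⊔ z → u = x ⊔ (y ⊓ z)

/-- Meet-semidistributivity: `w = x ⊓ y = x ⊓ z` implies `w = x ⊓ (y ⊔ z)`. -/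
def MeetSD (L : Type*) [Lattice L] : Prop :=
  ∀ w x y z : L, w = x ⊓ y → w = x ⊓ z → w = x ⊓ (y ⊔ z)

/-- Semidistributivity. -/
def SD (L : Type*) [Lattice L] : Prop := JoinSD L ∧ MeetSD L

/-- A congruence of a lattice: an equivalence relation compatible with `⊔` and `⊓`. -/
@[ext]
structure LatCon (L : Type*) [Lattice L] where
  r : L → L → Prop
  refl' : ∀ x, r x x
  symm' : ∀ {x y}, r x y → r y x
  trans' : ∀ {x y z}, r x y → r y z → r x z
  sup' : ∀ {x y x' y'}, r x y → r x' y' → r (x ⊔ x') (y ⊔ y')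
  inf' : ∀ {x y x' y'}, r x y → r x' y' → r (x ⊓ x') (y ⊓ y')

namespace LatCon

variable {L : Type*} [Lattice L]

/-- Congruences are ordered by inclusion; this is the order of the congruence
lattice `Con L`. -/
instance instPO : PartialOrder (LatCon L) where
  le c d := ∀ x y, c.r x y → d.r x y
  le_refl _ _ _ h := h
  le_trans _ _ _ h1 h2 x y h := h2 x y (h1 x y h)
  le_antisymm c d h1 h2 := by
    ext x y
    exact ⟨h1 x y, h2 x y⟩

/-- The congruence lattice `Con L`. -/
instance instLattice : Lattice (LatCon L) where
  sup c d :=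
    { r := fun x y => ∀ e : LatCon L, c ≤ e → d ≤ e → e.r x y
      refl' := fun x e _ _ => e.refl' x
      symm' := fun h e hc hd => e.symm' (h e hc hd)
      trans' := fun h1 h2 e hc hd => e.trans' (h1 e hc hd) (h2 e hc hd)
      sup' := fun h1 h2 e hc hd => e.sup' (h1 e hc hd) (h2 e hc hd)
      inf' := fun h1 h2 e hc hd => e.inf' (h1 e hc hd) (h2 e hc hd) }
  le_sup_left c d := fun x y h e hc _ => hc x y h
  le_sup_right c d := fun x y h e _ hd => hd x y h
  sup_le c d e hc hd := fun x y h => h e hc hd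
  inf c d :=
    { r := fun x y => c.r x y ∧ d.r x y
      refl' := fun x => ⟨c.refl' x, d.refl' x⟩
      symm' := fun h => ⟨c.symm' h.1, d.symm' h.2⟩
      trans' := fun h1 h2 => ⟨c.trans' h1.1 h2.1, d.trans' h1.2 h2.2⟩
      sup' := fun h1 h2 => ⟨c.sup' h1.1 h2.1, d.sup' h1.2 h2.2⟩
      inf' := fun h1 h2 => ⟨c.inf' h1.1 h2.1, d.inf' h1.2 h2.2⟩ }
  inf_le_left c d := fun x y h => h.1
  inf_le_right c d := fun x y h => h.2
  le_inf c d e hc hd := fun x y h => ⟨hc x y h, hd x y h⟩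

/-- The equality congruence is the least congruence. -/
instance instOrderBot : OrderBot (LatCon L) where
  bot :=
    { r := Eq
      refl' := fun _ => rfl
      symm' := Eq.symm
      trans' := Eq.trans
      sup' := by rintro x y x' y' rfl rfl; rfl
      inf' := by rintro x y x' y' rfl rfl; rfl }
  bot_le c := by rintro x y rfl; exact c.refl' x

/-- The all congruence is the greatest congruence. -/
instance instOrderTop : OrderTop (LatCon L) where
  top :=
    { r := fun _ _ => True
      refl' := fun _ => trivial
      symm' := fun _ => trivial
      trans' := fun _ _ => trivial
      sup' := fun _ _ => trivial
      inf' := fun _ _ => trivial }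
  le_top _ _ _ _ := trivial

/-- The congruence generated by a pair `(a, b)`. -/
def gen (a b : L) : LatCon L where
  r x y := ∀ c : LatCon L, c.r a b → c.r x y
  refl' x := fun c _ => c.refl' x
  symm' h := fun c hc => c.symm' (h c hc)
  trans' h1 h2 := fun c hc => c.trans' (h1 c hc) (h2 c hc)
  sup' h1 h2 := fun c hc => c.sup' (h1 c hc) (h2 c hc)
  inf' h1 h2 := fun c hc => c.inf' (h1 c hc) (h2 c hc)

/-- The congruence generated by a set of pairs. -/
def genSet (P : Set (L × L)) : LatCon L where
  r x y := ∀ c : LatCon L, (∀ p ∈ P, c.r p.1 p.2) → c.r x y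
  refl' x := fun c _ => c.refl' x
  symm' h := fun c hc => c.symm' (h c hc)
  trans' h1 h2 := fun c hc => c.trans' (h1 c hc) (h2 c hc)
  sup' h1 h2 := fun c hc => c.sup' (h1 c hc) (h2 c hc)
  inf' h1 h2 := fun c hc => c.inf' (h1 c hc) (h2 c hc)

end LatCon

/-- A lattice is simple if its congruence lattice has exactly two elements, namely
the equality relation (`⊥`) and the all relation (`⊤`). -/
def IsSimpleLat (L : Type*) [Lattice L] : Prop :=
  (∃ x y : L, x ≠ y) ∧ ∀ c : LatCon L, c = (⊥ : LatCon L) ∨ c = (⊤ : LatCon L)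

/-- An FN lattice: a simple, infinite, semidistributive lattice. -/
def IsFN (F : Type*) [Lattice F] : Prop := Infinite F ∧ IsSimpleLat F ∧ SD F

/-! ### Helpers for quantifying over lattice structures -/

/-- `SD` for an explicitly given lattice structure. -/
def SDP (K : Type*) (instK : Lattice K) : Prop := by
  letI := instK; exact SD K

/-- `IsFN` for an explicitly given lattice structure. -/
def IsFNP (F : Type*) (instF : Lattice F) : Prop := by
  letI := instF; exact IsFN F

/-- The congruence lattice of `K` (with explicitly given lattice structure) is
order-isomorphic to `D`. -/
def ConIso (K : Type*) (instK : Lattice K) (D : Type*) [LE D] : Prop := by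
  letI := instK; exact Nonempty (LatCon K ≃o D)

/-- `K` (with explicitly given lattice structure) has no greatest and no least element. -/
def UnboundedP (K : Type*) (instK : Lattice K) : Prop := by
  letI := instK; exact (∀ x : K, ¬ IsTop x) ∧ (∀ x : K, ¬ IsBot x)

/-- The order `≤` of an explicitly given lattice structure. -/
def lleOf {α : Type*} (inst : Lattice α) (x y : α) : Prop := by
  letI := inst; exact x ≤ y

/-- The join of an explicitly given lattice structure. -/
def lsupOf {α : Type*} (inst : Lattice α) (x y : α) : α := by
  letI := inst; exact x ⊔ y

/-- The meet of an explicitly given lattice structure. -/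
def linfOf {α : Type*} (inst : Lattice α) (x y : α) : α := by
  letI := inst; exact x ⊓ y

/-! ### The doubling construction -/

/-- The underlying set of the doubling `L[u]`: `(L ∖ {u}) ∪ {u₀, u₁}`, where
`u₀ = Sum.inr false` and `u₁ = Sum.inr true`. -/
def Doubled (L : Type*) (u : L) : Type _ := {x : L // x ≠ u} ⊕ Bool

/-- The element `u₀` of `L[u]`. -/
def dbl0 {L : Type*} (u : L) : Doubled L u := Sum.inr false

/-- The element `u₁` of `L[u]`. -/
def dbl1 {L : Type*} (u : L) : Doubled L u := Sum.inr true

/-- The order `≤ᵤ` of the doubling `L[u]`. -/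
def dle {L : Type*} [Lattice L] (u : L) : Doubled L u → Doubled L u → Prop
  | Sum.inl x, Sum.inl y => (x : L) ≤ y
  | Sum.inl x, Sum.inr _ => (x : L) ≤ u
  | Sum.inr _, Sum.inl y => u ≤ (y : L)
  | Sum.inr i, Sum.inr j => i ≤ j

section
open Classical

/-- The map `L → L[u]` sending `u` to `u₀` and fixing everything else. -/
noncomputable def iota0 {L : Type*} (u : L) : L → Doubled L u := fun x =>
  if h : x = u then Sum.inr false else Sum.inl ⟨x, h⟩

/-- The map `L → L[u]` sending `u` to `u₁` and fixing everything else. -/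
noncomputable def iota1 {L : Type*} (u : L) : L → Doubled L u := fun x =>
  if h : x = u then Sum.inr true else Sum.inl ⟨x, h⟩

end

/-- The projection `L[u] → L` collapsing `u₀` and `u₁` to `u`. -/
def dproj {L : Type*} (u : L) : Doubled L u → L
  | Sum.inl x => (x : L)
  | Sum.inr _ => u

/-! ### Doubling a finite antichain -/

/-- The underlying set of `L[U]`: `(L ∖ U) ∪ ⋃_{u ∈ U} {u₀, u₁}`, where
`u₀ = Sum.inr (u, false)` and `u₁ = Sum.inr (u, true)`. -/
def DoubledS (L : Type*) (U : Set L) : Type _ := {x : L // x ∉ U} ⊕ (U × Bool)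

section
open Classical

/-- The order of `L[U]`. -/
noncomputable def dleS {L : Type*} [Lattice L] (U : Set L) : DoubledS L U → DoubledS L U → Prop
  | Sum.inl x, Sum.inl y => (x : L) ≤ y
  | Sum.inl x, Sum.inr ui => (x : L) ≤ (ui.1 : L)
  | Sum.inr ui, Sum.inl y => (ui.1 : L) ≤ (y : L)
  | Sum.inr ui, Sum.inr vj =>
      if (ui.1 : L) = (vj.1 : L) then ui.2 ≤ vj.2 else (ui.1 : L) ≤ (vj.1 : L)

end

/-! ### Isolated intervals and the gluing construction -/

/-- An interval `[a, b]` is isolated if `b` covers `a` and both `a` and `b` are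
doubly irreducible. -/
def Isolated {L : Type*} [Lattice L] (a b : L) : Prop :=
  a ⋖ b ∧ SupIrred a ∧ InfIrred a ∧ SupIrred b ∧ InfIrred b

/-- The underlying set of `K = L^{a,b} ⊔ F`. -/
def Glued (L F : Type*) (a b : L) : Type _ := {x : L // x ≠ a ∧ x ≠ b} ⊕ F

/-- The order on `K = L^{a,b} ⊔ F`: on each summand the original order; and
`x < f` for `x ∈ L^{a,b}`, `f ∈ F` iff `x ≤ a`, `f < x` iff `b ≤ x`. -/
def gle {L F : Type*} [Lattice L] [Lattice F] (a b : L) :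
    Glued L F a b → Glued L F a b → Prop
  | Sum.inl x, Sum.inl y => (x : L) ≤ y
  | Sum.inl x, Sum.inr _ => (x : L) ≤ a
  | Sum.inr _, Sum.inl y => b ≤ (y : L)
  | Sum.inr f, Sum.inr g => f ≤ g


/-- Adjoining a greatest element preserves join-semidistributivity. -/
theorem JoinSD.withTop {L : Type*} [Lattice L] (h : JoinSD L) : JoinSD (WithTop L) := by
  intro u x y z hy hz
  subst hy
  induction x with
  | top => simp
  | coe x =>
    induction y with
    | top =>
      induction z with
      | top => simp
      | coe z => simp [← WithTop.coe_sup] at hz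
    | coe y =>
      induction z with
      | top => simp [← WithTop.coe_sup] at hz
      | coe z =>
        simp only [← WithTop.coe_sup, ← WithTop.coe_inf, WithTop.coe_inj] at hz ⊢
        exact h _ x y z rfl hz

/-- Adjoining a greatest element preserves meet-semidistributivity. -/
theorem MeetSD.withTop {L : Type*} [Lattice L] (h : MeetSD L) : MeetSD (WithTop L) := by
  intro w x y z hy hz
  subst hy
  induction x with
  | top => simp_all
  | coe x =>
    induction y with
    | top => simp
    | coe y =>
      induction z with
      | top => simpa using hz
      | coe z =>
        simp only [← WithTop.coe_sup, ← WithTop.coe_inf, WithTop.coe_inj] at hz ⊢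
        exact h _ x y z rfl hz

/-- `I` is closed downwards and under joins, and does not contain `t`. -/
structure IsIdealAvoiding {L : Type*} [Lattice L] (t : L) (I : Set L) : Prop where
  mem_of_le : ∀ {x y}, x ≤ y → y ∈ I → x ∈ I
  sup_mem : ∀ {x y}, x ∈ I → y ∈ I → x ⊔ y ∈ I
  notMem : t ∉ I

/-- In a join-semidistributive lattice with greatest element `t`, every element other than
`t` lies in a prime ideal. -/
theorem JoinSD.exists_prime_ideal {L : Type*} [Lattice L] (h : JoinSD L) {t a : L}
    (ht : IsTop t) (ha : a ≠ t) :
    ∃ I : Set L, a ∈ I ∧ IsIdealAvoiding t I ∧ ∀ x y, x ⊓ y ∈ I → x ∈ I ∨ y ∈ I := by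
  obtain ⟨I, haI, hI⟩ := zorn_subset_nonempty {I : Set L | IsIdealAvoiding t I}
    (fun C hC hchain _ => ⟨⋃₀ C, ⟨fun hxy ⟨J, hJ, hy⟩ => ⟨J, hJ, (hC hJ).mem_of_le hxy hy⟩,
      fun {x y} ⟨J, hJ, hx⟩ ⟨K, hK, hy⟩ => by
        rcases hchain.total hJ hK with hJK | hKJ
        · exact ⟨K, hK, (hC hK).sup_mem (hJK hx) hy⟩
        · exact ⟨J, hJ, (hC hJ).sup_mem hx (hKJ hy)⟩,
      fun ⟨J, hJ, hx⟩ => (hC hJ).notMem hx⟩, fun J hJ => Set.subset_sUnion_of_mem hJ⟩)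
    (Set.Iic a) ⟨fun hxy hy => hxy.trans hy, fun hx hy => sup_le hx hy,
      fun hta => ha (le_antisymm (ht a) hta)⟩
  have hmem : IsIdealAvoiding t I := hI.prop
  have haI : a ∈ I := haI le_rfl
  refine ⟨I, haI, hmem, ?_⟩
  have cofinal : ∀ x, x ∉ I → ∃ b ∈ I, b ⊔ x = t := by
    intro x hx
    by_contra! hne
    let J : Set L := {y | ∃ b ∈ I, y ≤ b ⊔ x}
    have hJ : IsIdealAvoiding t J :=
      ⟨fun hyz ⟨b, hb, hz⟩ => ⟨b, hb, hyz.trans hz⟩,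
        fun {y z} ⟨b, hb, hy⟩ ⟨c, hc, hz⟩ => ⟨b ⊔ c, hmem.sup_mem hb hc, sup_le
          (hy.trans (sup_le_sup_right le_sup_left x)) (hz.trans (sup_le_sup_right le_sup_right x))⟩,
        fun ⟨b, hb, htb⟩ => hne b hb (le_antisymm (ht _) htb)⟩
    exact hx (hI.le_of_ge hJ (fun y hy => ⟨y, hy, le_sup_left⟩) ⟨a, haI, le_sup_right⟩)
  intro x y hxy
  by_contra! hnot
  obtain ⟨b, hb, hbx⟩ := cofinal x hnot.1
  obtain ⟨c, hc, hcy⟩ := cofinal y hnot.2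
  have hx : t = (b ⊔ c) ⊔ x :=
    le_antisymm (hbx ▸ sup_le_sup_right le_sup_left x) (ht _)
  have hy : t = (b ⊔ c) ⊔ y :=
    le_antisymm (hcy ▸ sup_le_sup_right le_sup_right y) (ht _)
  refine hmem.notMem ?_
  rw [h t _ x y hx hy]
  exact hmem.sup_mem (hmem.sup_mem hb hc) hxy

/-- An infinite simple join-semidistributive lattice has no greatest element. -/
theorem IsSimpleLat.not_isTop {L : Type*} [Lattice L] [Infinite L] (hs : IsSimpleLat L)
    (h : JoinSD L) (t : L) : ¬ IsTop t := by
  intro ht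
  obtain ⟨a, ha⟩ := exists_ne t
  obtain ⟨I, haI, hI, hprime⟩ := h.exists_prime_ideal ht ha
  have sup_iff : ∀ x y, x ⊔ y ∈ I ↔ x ∈ I ∧ y ∈ I := fun x y =>
    ⟨fun hxy => ⟨hI.mem_of_le le_sup_left hxy, hI.mem_of_le le_sup_right hxy⟩,
      fun hxy => hI.sup_mem hxy.1 hxy.2⟩
  have inf_iff : ∀ x y, x ⊓ y ∈ I ↔ x ∈ I ∨ y ∈ I := fun x y =>
    ⟨hprime x y, fun hxy => hxy.elim (hI.mem_of_le inf_le_left) (hI.mem_of_le inf_le_right)⟩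
  let c : LatCon L :=
    { r := fun x y => x ∈ I ↔ y ∈ I
      refl' := fun _ => Iff.rfl
      symm' := Iff.symm
      trans' := Iff.trans
      sup' := fun h1 h2 => by rw [sup_iff, sup_iff, h1, h2]
      inf' := fun h1 h2 => by rw [inf_iff, inf_iff, h1, h2] }
  rcases hs.2 c with hc | hc
  · have inj : Function.Injective (fun x => x ∈ I) := fun x y hxy => by
      have hr : c.r x y := iff_of_eq hxy
      rw [hc] at hr
      exact hr
    exact not_finite_iff_infinite.mpr ‹_› (Finite.of_injective _ inj)
  · have hr : c.r a t := by rw [hc]; trivial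
    exact hI.notMem (hr.mp haI)

namespace LatCon

/-- The restriction of a congruence of `WithTop L` to `L`. -/
def restrictCoe {L : Type*} [Lattice L] (d : LatCon (WithTop L)) : LatCon L where
  r x y := d.r x y
  refl' x := d.refl' x
  symm' h := d.symm' h
  trans' h1 h2 := d.trans' h1 h2
  sup' h1 h2 := d.sup' h1 h2
  inf' h1 h2 := d.inf' h1 h2

/-- The congruence of `WithTop L` whose classes are `L` and `{⊤}`. -/
def collapseCoe (L : Type*) [Lattice L] : LatCon (WithTop L) where
  r x y := x = ⊤ ↔ y = ⊤
  refl' _ := Iff.rfl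
  symm' := Iff.symm
  trans' := Iff.trans
  sup' {x y x' y'} h1 h2 := by
    have sup_eq_top : ∀ u v : WithTop L, u ⊔ v = ⊤ ↔ u = ⊤ ∨ v = ⊤ := by
      intro u v
      induction u <;> induction v <;> simp [← WithTop.coe_sup]
    rw [sup_eq_top, sup_eq_top, h1, h2]
  inf' h1 h2 := by rw [inf_eq_top_iff, inf_eq_top_iff, h1, h2]

theorem collapseCoe_r_iff {L : Type*} [Lattice L] (x y : WithTop L) :
    (collapseCoe L).r x y ↔ x = y ∨ (x ≠ ⊤ ∧ y ≠ ⊤) := by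
  change (x = ⊤ ↔ y = ⊤) ↔ _
  induction x <;> induction y <;> simp

theorem collapseCoe_ne_bot {L : Type*} [Lattice L] [Nontrivial L] : collapseCoe L ≠ ⊥ := by
  intro h
  obtain ⟨x, y, hxy⟩ := exists_pair_ne L
  have hr : (collapseCoe L).r x y := by simp [collapseCoe]
  rw [h] at hr
  exact hxy (WithTop.coe_injective hr)

theorem collapseCoe_ne_top {L : Type*} [Lattice L] [Nonempty L] : collapseCoe L ≠ ⊤ := by
  intro h
  obtain ⟨x⟩ := ‹Nonempty L›
  have hr : (collapseCoe L).r x ⊤ := by rw [h]; trivial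
  simp [collapseCoe] at hr

theorem eq_bot_of_restrictCoe_eq_bot {L : Type*} [Lattice L] (hL : ∀ t : L, ¬ IsTop t)
    {d : LatCon (WithTop L)} (hd : d.restrictCoe = ⊥) : d = ⊥ := by
  have coe_eq : ∀ x y : L, d.r x y → x = y := by
    intro x y h
    have hr : d.restrictCoe.r x y := h
    rw [hd] at hr
    exact hr
  have not_top : ∀ x : L, ¬ d.r x ⊤ := by
    intro x hx
    refine hL x fun y => ?_
    have hxy : d.r (x ⊔ y : L) ⊤ := by
      simpa using d.sup' hx (d.refl' (y : WithTop L))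
    exact sup_eq_left.mp (coe_eq _ _ (d.trans' hxy (d.symm' hx)))
  refine le_bot_iff.mp fun x y h => ?_
  induction x with
  | top =>
    induction y with
    | top => rfl
    | coe y => exact (not_top y (d.symm' h)).elim
  | coe x =>
    induction y with
    | top => exact (not_top x h).elim
    | coe y => exact congrArg _ (coe_eq x y h)

theorem eq_collapseCoe_or_eq_top {L : Type*} [Lattice L] {d : LatCon (WithTop L)}
    (hd : d.restrictCoe = ⊤) : d = collapseCoe L ∨ d = ⊤ := by
  have coe_rel : ∀ x y : L, d.r x y := by
    intro x y
    change d.restrictCoe.r x y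
    rw [hd]
    trivial
  by_cases hx : ∃ x : L, d.r x ⊤
  · obtain ⟨x, hx⟩ := hx
    have rel_top : ∀ y, d.r y ⊤ := by
      intro y
      induction y with
      | top => exact d.refl' _
      | coe y => exact d.trans' (coe_rel y x) hx
    exact Or.inr (top_le_iff.mp fun y z _ => d.trans' (rel_top y) (d.symm' (rel_top z)))
  · push Not at hx
    left
    ext x y
    rw [collapseCoe_r_iff]
    induction x with
    | top =>
      induction y with
      | top => simpa using d.refl' _
      | coe y => simpa using fun h => hx y (d.symm' h)
    | coe x =>
      induction y with
      | top => simpa using hx x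
      | coe y => simpa using coe_rel x y

end LatCon

/-- A bounded order with exactly one element besides `⊥` and `⊤` is a three-element chain. -/
theorem nonempty_orderIso_fin_three {P : Type*} [PartialOrder P] [BoundedOrder P] {c : P}
    (hbot : c ≠ ⊥) (htop : c ≠ ⊤) (h : ∀ d : P, d ≠ ⊥ → d ≠ ⊤ → d = c) :
    Nonempty (P ≃o Fin 3) := by
  have mono : StrictMono ![⊥, c, ⊤] := by
    rw [Fin.strictMono_iff_lt_succ]
    intro i
    fin_cases i
    · exact bot_lt_iff_ne_bot.mpr hbot
    · exact lt_top_iff_ne_top.mpr htop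
  refine ⟨(mono.orderIsoOfSurjective _ fun d => ?_).symm⟩
  by_cases hd : d = ⊥
  · exact ⟨0, hd.symm⟩
  by_cases hd' : d = ⊤
  · exact ⟨2, hd'.symm⟩
  · exact ⟨1, (h d hd hd').symm⟩

/-! ### STATEMENT 6 -/

/-- Let `F` be an FN lattice and `F⁺ = WithTop F` the lattice `F` with a new
greatest element adjoined.  Then `F⁺` is an infinite semidistributive lattice, its
congruence lattice is a three-element chain, and its unique nontrivial proper
congruence has exactly one nontrivial class, namely `F`. -/
theorem statement6 (F : Type) [Lattice F] (hF : IsFN F) :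
    Infinite (WithTop F) ∧ SD (WithTop F) ∧
    Nonempty (LatCon (WithTop F) ≃o Fin 3) ∧
    ∃ c : LatCon (WithTop F),
      c ≠ ⊥ ∧ c ≠ ⊤ ∧
      (∀ d : LatCon (WithTop F), d ≠ ⊥ → d ≠ ⊤ → d = c) ∧
      (∀ x y : WithTop F, c.r x y ↔ (x = y ∨ (x ≠ (⊤ : WithTop F) ∧ y ≠ (⊤ : WithTop F)))) := by
  obtain ⟨hinf, hsimple, hjoin, hmeet⟩ := hF
  have noTop := hsimple.not_isTop hjoin
  have unique : ∀ d : LatCon (WithTop F), d ≠ ⊥ → d ≠ ⊤ → d = LatCon.collapseCoe F := by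
    intro d hbot htop
    rcases hsimple.2 d.restrictCoe with hd | hd
    · exact (hbot (LatCon.eq_bot_of_restrictCoe_eq_bot noTop hd)).elim
    · exact (LatCon.eq_collapseCoe_or_eq_top hd).resolve_right htop
  let _ : BoundedOrder (LatCon (WithTop F)) := {}
  exact ⟨Infinite.of_injective _ WithTop.coe_injective, ⟨hjoin.withTop, hmeet.withTop⟩,
    nonempty_orderIso_fin_three LatCon.collapseCoe_ne_bot LatCon.collapseCoe_ne_top unique,
    LatCon.collapseCoe F, LatCon.collapseCoe_ne_bot, LatCon.collapseCoe_ne_top, unique,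
    LatCon.collapseCoe_r_iff⟩
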